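/- Let G be a smallest counterexample, let v be a vertex of G of degree 3, and suppose v is an end of a 2-string v v1 x y (so v1 and x have degree two in G). Let v2 and v3 be the two neighbors of v distinct from v1. Then the path v2 v v3 is contained in a 5-cycle of G. -/

import Mathlib

open SimpleGraph

/-- The degree of a vertex, as the cardinality of its neighbor set. -/
noncomputable def deg {V : Type} (G : SimpleGraph V) (v : V) : ℕ :=
  (G.neighborSet v).ncard

/-- The potential of a finite graph: `5 n(G) - 4 e(G)`. -/
noncomputable def pot {V : Type} [Fintype V] (G : SimpleGraph V) : ℤ :=
  5 * (Fintype.card V : ℤ) - 4 * (G.edgeSet.ncard : ℤ)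

/-- A graph is 5/2-critical if it has no homomorphism to the 5-cycle
but every proper subgraph has one. -/
def Critical52 {V : Type} (G : SimpleGraph V) : Prop :=
  IsEmpty (G →g cycleGraph 5) ∧
  ∀ H : G.Subgraph, H ≠ ⊤ → Nonempty (H.coe →g cycleGraph 5)

/-- The exceptional graph `E₁`: a 9-cycle `0 1 2 3 4 5 6 7 8` together
with a vertex `9` adjacent to `0`, `3` and `6`. -/
def E1 : SimpleGraph (Fin 10) := SimpleGraph.fromEdgeSet
  {s(0,1), s(1,2), s(2,3), s(3,4), s(4,5), s(5,6), s(6,7), s(7,8), s(8,0),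
   s(9,0), s(9,3), s(9,6)}

/-- The exceptional graph `E₂`: two 5-cycles `0 1 2 3 4` and `0 1 5 6 7`
sharing exactly the edge `01`, together with a path `3 8 9 6`. -/
def E2 : SimpleGraph (Fin 10) := SimpleGraph.fromEdgeSet
  {s(0,1), s(1,2), s(2,3), s(3,4), s(4,0),
   s(1,5), s(5,6), s(6,7), s(7,0),
   s(3,8), s(8,9), s(9,6)}

/-- A smallest counterexample: a 5/2-critical graph, not isomorphic to `C₃`, `E₁`, `E₂`,
with potential at least 2, such that every smaller 5/2-critical graph not isomorphic
to `C₃`, `E₁`, `E₂` has potential at most 1. -/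
def SmallestCex {V : Type} [Fintype V] (G : SimpleGraph V) : Prop :=
  Critical52 G ∧ IsEmpty (G ≃g cycleGraph 3) ∧ IsEmpty (G ≃g E1) ∧ IsEmpty (G ≃g E2) ∧
  2 ≤ pot G ∧
  ∀ (m : ℕ) (H : SimpleGraph (Fin m)), Critical52 H →
    IsEmpty (H ≃g cycleGraph 3) → IsEmpty (H ≃g E1) → IsEmpty (H ≃g E2) →
    m < Fintype.card V → pot H ≤ 1

/-- A string: a path of positive length whose endvertices have degree at least 3
and whose internal vertices have degree 2. A `k`-string is a string of length `k+1`. -/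
def IsString {V : Type} (G : SimpleGraph V) {u v : V} (p : G.Walk u v) : Prop :=
  p.IsPath ∧ 0 < p.length ∧ 3 ≤ deg G u ∧ 3 ≤ deg G v ∧
  ∀ w ∈ p.support, w ≠ u → w ≠ v → deg G w = 2

/-- `v` lies on a 5-cycle of `G`. -/
def InFiveCycle {V : Type} (G : SimpleGraph V) (v : V) : Prop :=
  ∃ (w : V) (c : G.Walk w w), c.IsCycle ∧ c.length = 5 ∧ v ∈ c.support

/-- `v` is a `(k₁,k₂,k₃)`-vertex: it has degree 3 and is the end of a `k₁`-string,
a `k₂`-string and a `k₃`-string leaving `v` through its three distinct edges. -/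
def IsVertex3 {V : Type} (G : SimpleGraph V) (v : V) (k1 k2 k3 : ℕ) : Prop :=
  deg G v = 3 ∧ ∃ (u1 u2 u3 : V) (p1 : G.Walk v u1) (p2 : G.Walk v u2) (p3 : G.Walk v u3),
    IsString G p1 ∧ IsString G p2 ∧ IsString G p3 ∧
    p1.getVert 1 ≠ p2.getVert 1 ∧ p1.getVert 1 ≠ p3.getVert 1 ∧ p2.getVert 1 ≠ p3.getVert 1 ∧
    p1.length = k1 + 1 ∧ p2.length = k2 + 1 ∧ p3.length = k3 + 1

/-- `v` is a `(k₁,k₂,k₃,k₄)`-vertex: it has degree 4 and is the end of strings of the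
corresponding lengths leaving `v` through its four distinct edges. -/
def IsVertex4 {V : Type} (G : SimpleGraph V) (v : V) (k1 k2 k3 k4 : ℕ) : Prop :=
  deg G v = 4 ∧ ∃ (u1 u2 u3 u4 : V) (p1 : G.Walk v u1) (p2 : G.Walk v u2)
    (p3 : G.Walk v u3) (p4 : G.Walk v u4),
    IsString G p1 ∧ IsString G p2 ∧ IsString G p3 ∧ IsString G p4 ∧
    p1.getVert 1 ≠ p2.getVert 1 ∧ p1.getVert 1 ≠ p3.getVert 1 ∧ p1.getVert 1 ≠ p4.getVert 1 ∧
    p2.getVert 1 ≠ p3.getVert 1 ∧ p2.getVert 1 ≠ p4.getVert 1 ∧ p3.getVert 1 ≠ p4.getVert 1 ∧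
    p1.length = k1 + 1 ∧ p2.length = k2 + 1 ∧ p3.length = k3 + 1 ∧ p4.length = k4 + 1

/-- `H` contains at least two distinct cycles, where cycles are counted as subgraphs,
i.e. two cycles are distinct if their edge sets differ. -/
def TwoDistinctCycles {V : Type} (H : SimpleGraph V) : Prop :=
  ∃ (v1 v2 : V) (c1 : H.Walk v1 v1) (c2 : H.Walk v2 v2),
    c1.IsCycle ∧ c2.IsCycle ∧ {e | e ∈ c1.edges} ≠ {e | e ∈ c2.edges}

/-- The degree of a 5-cycle (cell) `c` in `G`: the number of strings not contained in `c`
that intersect `c`, strings being counted by their edge sets. -/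
noncomputable def cellDegree {V : Type} (G : SimpleGraph V) {w : V} (c : G.Walk w w) : ℕ :=
  {S : Set (Sym2 V) | ∃ (u v : V) (p : G.Walk u v), IsString G p ∧ S = {e | e ∈ p.edges} ∧
    ¬ S ⊆ {e | e ∈ c.edges} ∧ ∃ x ∈ p.support, x ∈ c.support}.ncard


/-! ### Colorings as functions -/

/-- `f` is a homomorphism to the 5-cycle. -/
def IsCol {V : Type} (G : SimpleGraph V) (f : V → Fin 5) : Prop :=
  ∀ a b, G.Adj a b → (cycleGraph 5).Adj (f a) (f b)

lemma noncol_iff {V : Type} (G : SimpleGraph V) :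
    IsEmpty (G →g cycleGraph 5) ↔ ¬ ∃ f, IsCol G f := by
  constructor
  · rintro h ⟨f, hf⟩
    exact h.false ⟨f, fun {a b} hab => hf a b hab⟩
  · intro h
    exact ⟨fun g => h ⟨g, fun a b hab => g.map_adj hab⟩⟩

lemma crit_col_missing {V : Type} {G : SimpleGraph V} (h : Critical52 G) (S : Set V) (w : V)
    (hw : w ∉ S) :
    ∃ f : V → Fin 5, ∀ a ∈ S, ∀ b ∈ S, G.Adj a b → (cycleGraph 5).Adj (f a) (f b) := by
  classical
  have hne : (⊤ : G.Subgraph).induce S ≠ ⊤ := by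
    intro he
    have : w ∈ ((⊤ : G.Subgraph).induce S).verts := by rw [he]; trivial
    exact hw (by simpa using this)
  obtain ⟨g⟩ := h.2 _ hne
  refine ⟨fun a => if ha : a ∈ S then g ⟨a, by simpa using ha⟩ else 0, ?_⟩
  intro a ha b hb hab
  simp only [ha, hb, dif_pos]
  apply g.map_adj
  simp [Subgraph.induce, ha, hb, hab]

lemma no_hom_missing {V U : Type} {G : SimpleGraph V} {K : SimpleGraph U} (h : Critical52 G)
    (hK : Critical52 K) (e : U → V) (v : V) (hv : ∀ i, e i ≠ v)
    (he : ∀ i k, K.Adj i k → G.Adj (e i) (e k)) : False := by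
  obtain ⟨f, hf⟩ := crit_col_missing h {a | a ≠ v} v (by simp)
  exact (noncol_iff K).1 hK.1 ⟨f ∘ e, fun i k hik => hf _ (hv i) _ (hv k) (he i k hik)⟩

/-- Extraction of a critical subgraph. -/
lemma exists_critical {W : Type} [Fintype W] (G : SimpleGraph W) (h : ¬ ∃ f, IsCol G f) :
    ∃ (m : ℕ) (K : SimpleGraph (Fin m)) (j : Fin m → W), Critical52 K ∧ Function.Injective j ∧
      ∀ i k, K.Adj i k → G.Adj (j i) (j k) := by
  classical
  let P : ℕ → Prop := fun n => ∃ (m : ℕ) (K : SimpleGraph (Fin m)) (j : Fin m → W),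
    (¬ ∃ f, IsCol K f) ∧ Function.Injective j ∧
      (∀ i k, K.Adj i k → G.Adj (j i) (j k)) ∧ n = m + K.edgeSet.ncard
  have hP : ∃ n, P n := by
    let e := Fintype.equivFin W
    refine ⟨_, Fintype.card W, G.comap e.symm, e.symm, ?_, e.symm.injective, fun i k hik => hik, rfl⟩
    rintro ⟨f, hf⟩
    exact h ⟨f ∘ e, fun a b hab => hf _ _ (by simpa using hab)⟩
  obtain ⟨m, K, j, hK, hj, hadj, hn⟩ := Nat.find_spec hP
  refine ⟨m, K, j, ⟨(noncol_iff K).2 hK, ?_⟩, hj, hadj⟩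
  intro H hH
  by_contra hcol
  -- transfer `H` to `Fin`
  let e := Fintype.equivFin H.verts
  let K' : SimpleGraph (Fin (Fintype.card H.verts)) := H.coe.comap e.symm
  have hK' : ¬ ∃ f, IsCol K' f := by
    rintro ⟨f, hf⟩
    exact hcol ⟨⟨f ∘ e, fun {a b} hab => hf _ _ (by simpa [K'] using hab)⟩⟩
  have hle : Nat.find hP ≤ Fintype.card H.verts + K'.edgeSet.ncard := by
    apply Nat.find_min'
    refine ⟨_, K', fun i => j (e.symm i), hK', ?_, ?_, rfl⟩
    · exact hj.comp (Subtype.val_injective.comp e.symm.injective)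
    · intro i k hik
      exact hadj _ _ (H.adj_sub hik)
  have hedge : K'.edgeSet.ncard ≤ H.edgeSet.ncard := by
    apply Set.ncard_le_ncard_of_injOn (fun s => s.map (fun i => ((e.symm i : H.verts) : Fin m)))
    · intro s
      induction s with
      | _ a b => intro hs; exact hs
    · apply Function.Injective.injOn
      exact Sym2.map.injective (Subtype.val_injective.comp e.symm.injective)
  have hedge2 : H.edgeSet.ncard ≤ K.edgeSet.ncard :=
    Set.ncard_le_ncard H.edgeSet_subset (Set.toFinite _)
  have hv : Fintype.card H.verts ≤ m := by
    simpa using Fintype.card_subtype_le (fun x => x ∈ H.verts)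
  have h1 : Fintype.card H.verts = m := by omega
  have h2 : H.edgeSet.ncard = K.edgeSet.ncard := by omega
  apply hH
  have hverts : H.verts = Set.univ := by
    apply Set.eq_of_subset_of_ncard_le (Set.subset_univ _) _ (Set.toFinite _)
    rw [Set.ncard_univ, Nat.card_eq_fintype_card, Fintype.card_fin, ← Nat.card_coe_set_eq,
      Nat.card_eq_fintype_card, h1]
  have hE : H.edgeSet = K.edgeSet :=
    Set.eq_of_subset_of_ncard_le H.edgeSet_subset h2.ge (Set.toFinite _)
  ext a b
  · simp [hverts]
  · rw [← Subgraph.mem_edgeSet, hE]; simp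

/-! ### Counting ordered pairs of adjacent vertices -/

open Classical in
/-- Ordered pairs of adjacent vertices inside `S`. -/
noncomputable def prs {V : Type} (G : SimpleGraph V) (S : Finset V) : Finset (V × V) :=
  (S ×ˢ S).filter (fun p => G.Adj p.1 p.2)

lemma mem_prs {V : Type} {G : SimpleGraph V} {S : Finset V} {p : V × V} :
    p ∈ prs G S ↔ p.1 ∈ S ∧ p.2 ∈ S ∧ G.Adj p.1 p.2 := by
  simp [prs, and_assoc]

/-- Twice the potential of the subgraph induced by `S`. -/
noncomputable def dpot {V : Type} (G : SimpleGraph V) (S : Finset V) : ℤ :=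
  10 * (S.card : ℤ) - 4 * ((prs G S).card : ℤ)

lemma card_prs_univ {V : Type} [Fintype V] (G : SimpleGraph V) :
    (prs G Finset.univ).card = 2 * G.edgeSet.ncard := by
  classical
  have h := G.dart_card_eq_twice_card_edges
  rw [Set.ncard_eq_toFinset_card', ← SimpleGraph.edgeFinset, ← h, ← Finset.card_univ]
  symm
  apply Finset.card_bij (fun (d : G.Dart) _ => d.toProd)
  · intro d _
    simp [mem_prs, d.adj]
  · intro a _ b _ hab
    exact SimpleGraph.Dart.ext _ _ hab
  · intro p hp
    exact ⟨⟨p, (mem_prs.1 hp).2.2⟩, Finset.mem_univ _, rfl⟩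

lemma dpot_univ {V : Type} [Fintype V] (G : SimpleGraph V) :
    dpot G Finset.univ = 2 * pot G := by
  rw [dpot, pot, card_prs_univ, Finset.card_univ]
  push_cast
  ring

lemma pot_iso {V W : Type} [Fintype V] [Fintype W] {G : SimpleGraph V} {H : SimpleGraph W}
    (e : G ≃g H) : pot G = pot H := by
  have h1 : Fintype.card V = Fintype.card W := Fintype.card_congr e.toEquiv
  have h2 : G.edgeSet.ncard = H.edgeSet.ncard := by
    rw [← Nat.card_coe_set_eq, ← Nat.card_coe_set_eq]
    exact Nat.card_congr e.mapEdgeSet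
  rw [pot, pot, h1, h2]

lemma pot_of_card {n k : ℕ} (G : SimpleGraph (Fin n)) [DecidableRel G.Adj]
    (h : ((Finset.univ : Finset (Fin n × Fin n)).filter (fun p => G.Adj p.1 p.2)).card = 2 * k) :
    pot G = 5 * n - 4 * k := by
  have : prs G Finset.univ = Finset.univ.filter (fun p => G.Adj p.1 p.2) := by
    ext p; simp [mem_prs]
  have h2 := card_prs_univ G
  rw [this, h] at h2
  rw [pot, Fintype.card_fin]
  have : G.edgeSet.ncard = k := by omega
  rw [this]

instance : DecidableRel E1.Adj := fun a b => by
  unfold E1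
  simp only [fromEdgeSet_adj, Set.mem_insert_iff, Set.mem_singleton_iff]
  infer_instance

instance : DecidableRel E2.Adj := fun a b => by
  unfold E2
  simp only [fromEdgeSet_adj, Set.mem_insert_iff, Set.mem_singleton_iff]
  infer_instance

lemma pot_C3 : pot (cycleGraph 3) = 3 := by
  rw [pot_of_card (k := 3) _ (by decide)]; norm_num

lemma pot_E1 : pot E1 = 2 := by
  rw [pot_of_card (k := 12) _ (by decide +kernel)]; norm_num

lemma pot_E2 : pot E2 = 2 := by
  rw [pot_of_card (k := 12) _ (by decide +kernel)]; norm_num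

lemma small_cases {V : Type} [Fintype V] {G : SimpleGraph V} (h : SmallestCex G) {m : ℕ}
    (K : SimpleGraph (Fin m)) (hK : Critical52 K) (hm : m < Fintype.card V) :
    (Nonempty (K ≃g cycleGraph 3) ∧ pot K = 3) ∨
    ((Nonempty (K ≃g E1) ∨ Nonempty (K ≃g E2)) ∧ pot K = 2) ∨ pot K ≤ 1 := by
  by_cases h3 : Nonempty (K ≃g cycleGraph 3)
  · obtain ⟨e⟩ := h3
    exact Or.inl ⟨⟨e⟩, by rw [pot_iso e, pot_C3]⟩
  by_cases h1 : Nonempty (K ≃g E1)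
  · obtain ⟨e⟩ := h1
    exact Or.inr (Or.inl ⟨Or.inl ⟨e⟩, by rw [pot_iso e, pot_E1]⟩)
  by_cases h2 : Nonempty (K ≃g E2)
  · obtain ⟨e⟩ := h2
    exact Or.inr (Or.inl ⟨Or.inr ⟨e⟩, by rw [pot_iso e, pot_E2]⟩)
  rw [not_nonempty_iff] at h1 h2 h3
  exact Or.inr (Or.inr (h.2.2.2.2.2 m K hK h3 h1 h2 hm))

lemma card_prs_insert {V : Type} [DecidableEq V] {G : SimpleGraph V} {S : Finset V} {w : V}
    (hw : w ∉ S) (D : Finset V) (hD : D ⊆ S) (hadj : ∀ d ∈ D, G.Adj w d) :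
    (prs G S).card + 2 * D.card ≤ (prs G (insert w S)).card := by
  have h1 : (D.image (fun d => (w, d))).card = D.card :=
    Finset.card_image_of_injective _ (fun a b hab => by simpa using hab)
  have h2 : (D.image (fun d => (d, w))).card = D.card :=
    Finset.card_image_of_injective _ (fun a b hab => by simpa using hab)
  have hsub : prs G S ∪ (D.image (fun d => (w, d)) ∪ D.image (fun d => (d, w)))
      ⊆ prs G (insert w S) := by
    intro p hp
    simp only [Finset.mem_union, Finset.mem_image] at hp
    rw [mem_prs]
    rcases hp with hp | ⟨d, hd, rfl⟩ | ⟨d, hd, rfl⟩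
    · have := mem_prs.1 hp
      simp [this.1, this.2.1, this.2.2]
    · simp [hD hd, hadj d hd]
    · simp [hD hd, (hadj d hd).symm]
  have h3 : Disjoint (D.image (fun d => (w, d))) (D.image (fun d => (d, w))) := by
    rw [Finset.disjoint_left]
    intro p hp hp'
    simp only [Finset.mem_image] at hp hp'
    obtain ⟨d, hd, rfl⟩ := hp
    obtain ⟨d', hd', he⟩ := hp'
    simp only [Prod.mk.injEq] at he
    exact hw (he.1 ▸ hD hd')
  have h4 : Disjoint (prs G S) (D.image (fun d => (w, d)) ∪ D.image (fun d => (d, w))) := by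
    rw [Finset.disjoint_left]
    intro p hp hp'
    have := mem_prs.1 hp
    simp only [Finset.mem_union, Finset.mem_image] at hp'
    rcases hp' with ⟨d, hd, rfl⟩ | ⟨d, hd, rfl⟩
    · exact hw this.1
    · exact hw this.2.1
  have := Finset.card_le_card hsub
  rw [Finset.card_union_of_disjoint h4, Finset.card_union_of_disjoint h3, h1, h2] at this
  omega

lemma dpot_insert {V : Type} [DecidableEq V] {G : SimpleGraph V} {S : Finset V} {w : V}
    (hw : w ∉ S) (D : Finset V) (hD : D ⊆ S) (hadj : ∀ d ∈ D, G.Adj w d) :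
    dpot G (insert w S) ≤ dpot G S + 10 - 8 * D.card := by
  have := card_prs_insert hw D hD hadj
  rw [dpot, dpot, Finset.card_insert_of_notMem hw]
  push_cast
  omega

/-! ### Flexible colorings of the exceptional graphs -/

/-- Edges of `E1`. -/
def edges1 : List (Fin 10 × Fin 10) :=
  [(0, 1), (1, 2), (2, 3), (3, 4), (4, 5), (5, 6), (6, 7), (7, 8), (8, 0), (9, 0), (9, 3), (9, 6)]

/-- Colorings of `E1` minus an edge. -/
def cols1 : List (Fin 10 → Fin 5) :=
  [![0, 2, 1, 0, 1, 2, 3, 2, 1, 4],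
   ![0, 1, 2, 0, 1, 2, 3, 2, 1, 4],
   ![0, 1, 2, 3, 1, 2, 3, 2, 1, 4],
   ![0, 1, 2, 3, 2, 1, 3, 2, 1, 4],
   ![0, 1, 2, 3, 2, 1, 0, 2, 1, 4],
   ![0, 1, 2, 3, 2, 1, 0, 1, 2, 4],
   ![0, 1, 0, 1, 0, 4, 3, 2, 1, 2],
   ![0, 1, 0, 1, 0, 4, 3, 2, 1, 4],
   ![0, 1, 2, 3, 4, 0, 1, 0, 1, 4],
   ![0, 1, 4, 0, 1, 2, 3, 2, 1, 4],
   ![0, 1, 2, 3, 2, 4, 3, 2, 1, 4],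
   ![0, 1, 2, 3, 2, 1, 0, 1, 4, 4],
   ![0, 1, 4, 0, 4, 3, 2, 3, 4, 1],
   ![0, 1, 2, 3, 4, 2, 3, 2, 1, 4],
   ![0, 1, 2, 3, 2, 1, 0, 4, 1, 4],
   ![0, 2, 1, 0, 4, 3, 2, 3, 4, 1],
   ![0, 1, 2, 0, 4, 3, 2, 3, 4, 1],
   ![0, 1, 2, 3, 0, 4, 3, 2, 1, 4],
   ![0, 1, 2, 3, 4, 0, 3, 2, 1, 4],
   ![0, 1, 2, 3, 2, 1, 0, 3, 4, 4],
   ![0, 1, 2, 3, 2, 1, 0, 4, 3, 4],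
   ![0, 1, 2, 3, 4, 0, 1, 0, 1, 2],
   ![0, 1, 2, 3, 2, 1, 2, 3, 4, 1],
   ![0, 1, 2, 3, 2, 1, 2, 3, 4, 4]]

/-- Edges of `E2`. -/
def edges2 : List (Fin 10 × Fin 10) :=
  [(0, 1), (1, 2), (2, 3), (3, 4), (4, 0), (1, 5), (5, 6), (6, 7), (7, 0), (3, 8), (8, 9), (9, 6)]

/-- Colorings of `E2` minus an edge. -/
def cols2 : List (Fin 10 → Fin 5) :=
  [![0, 2, 1, 0, 1, 1, 2, 1, 4, 3],
   ![0, 1, 3, 2, 1, 2, 3, 4, 1, 2],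
   ![0, 1, 0, 2, 1, 2, 3, 4, 1, 2],
   ![0, 1, 0, 1, 4, 2, 3, 4, 0, 4],
   ![0, 1, 0, 4, 3, 2, 3, 4, 0, 4],
   ![0, 1, 2, 3, 4, 3, 2, 1, 2, 1],
   ![0, 1, 2, 3, 4, 0, 2, 1, 2, 1],
   ![0, 1, 2, 3, 4, 0, 1, 4, 4, 0],
   ![0, 1, 2, 3, 4, 0, 4, 3, 4, 0],
   ![0, 1, 2, 3, 4, 2, 3, 4, 2, 4],
   ![0, 1, 2, 3, 4, 2, 3, 4, 0, 4],
   ![0, 1, 2, 3, 4, 2, 3, 4, 4, 0],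
   ![0, 1, 2, 3, 4, 2, 3, 4, 1, 2],
   ![0, 1, 2, 3, 4, 2, 3, 4, 2, 1],
   ![0, 2, 1, 2, 1, 1, 0, 1, 3, 4],
   ![0, 1, 4, 0, 1, 2, 3, 4, 1, 2],
   ![0, 1, 2, 0, 1, 2, 3, 4, 1, 2],
   ![0, 1, 0, 4, 1, 2, 3, 4, 0, 4],
   ![0, 1, 0, 1, 2, 2, 3, 4, 0, 4],
   ![0, 1, 2, 3, 4, 4, 0, 1, 2, 1],
   ![0, 1, 2, 3, 4, 2, 0, 1, 2, 1],
   ![0, 1, 2, 3, 4, 0, 4, 1, 2, 3],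
   ![0, 1, 2, 3, 4, 0, 1, 2, 4, 0],
   ![0, 1, 2, 3, 4, 2, 3, 4, 4, 2]]

/-- The test that `f` is a coloring of the graph with edge list `E` minus the edge `za`,
suitable for `t`. -/
def goodCol (E : List (Fin 10 × Fin 10)) (z a t : Fin 10) (f : Fin 10 → Fin 5) : Bool :=
  (decide (f a - f z = 2) || decide (f a - f z = 3)) && decide (f t ≠ 2 * f a - f z) &&
  E.all (fun e => decide (e = (z, a)) || decide (e = (a, z)) ||
    decide (f e.1 - f e.2 = 1) || decide (f e.2 - f e.1 = 1))

/-- For every edge `za` and vertex `t` there is a suitable coloring of `K - za`. -/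
def Flex {U : Type} (K : SimpleGraph U) : Prop :=
  ∀ z a t, K.Adj z a → ∃ f : U → Fin 5,
    (∀ p q, K.Adj p q → ¬ (p = z ∧ q = a) → ¬ (p = a ∧ q = z) →
      (cycleGraph 5).Adj (f p) (f q)) ∧
    (f a - f z = 2 ∨ f a - f z = 3) ∧ f t ≠ 2 * f a - f z

lemma flex_of_list (K : SimpleGraph (Fin 10)) (E : List (Fin 10 × Fin 10))
    (L : List (Fin 10 → Fin 5)) (hE : ∀ p q, K.Adj p q → (p, q) ∈ E ∨ (q, p) ∈ E)
    (hL : ∀ e ∈ E, ∀ t, (∃ f ∈ L, goodCol E e.1 e.2 t f = true) ∧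
      ∃ f ∈ L, goodCol E e.2 e.1 t f = true) : Flex K := by
  intro z a t hza
  have : ∃ f ∈ L, goodCol E z a t f = true := by
    rcases hE z a hza with h | h
    · exact (hL _ h t).1
    · exact (hL _ h t).2
  obtain ⟨f, -, hf⟩ := this
  simp only [goodCol, Bool.and_eq_true, Bool.or_eq_true, decide_eq_true_eq, List.all_eq_true] at hf
  obtain ⟨⟨h1, h2⟩, h3⟩ := hf
  refine ⟨f, ?_, h1, h2⟩
  intro p q hpq hn1 hn2
  rw [cycleGraph_adj]
  rcases hE p q hpq with h | h
  · rcases h3 _ h with ((h | h) | h) | h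
    · exact absurd (by simpa using h) hn1
    · exact absurd (by simpa using h) hn2
    · exact Or.inl h
    · exact Or.inr h
  · rcases h3 _ h with ((h | h) | h) | h
    · exact absurd (by simpa [and_comm] using h) hn2
    · exact absurd (by simpa [and_comm] using h) hn1
    · exact Or.inr h
    · exact Or.inl h

lemma flex_E1 : Flex E1 := by
  apply flex_of_list E1 edges1 cols1
  · decide +kernel
  · decide +kernel

lemma degree_E1 : ∀ z : Fin 10, (Finset.univ.filter (fun a => E1.Adj z a)).card ≤ 3 := by
  decide +kernel

lemma flex_E2 : Flex E2 := by
  apply flex_of_list E2 edges2 cols2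
  · decide +kernel
  · decide +kernel

lemma degree_E2 : ∀ z : Fin 10, (Finset.univ.filter (fun a => E2.Adj z a)).card ≤ 3 := by
  decide +kernel

lemma Flex.of_iso {U W : Type} {K : SimpleGraph U} {H : SimpleGraph W} (e : K ≃g H) (h : Flex H) :
    Flex K := by
  intro z a t hza
  obtain ⟨f, h1, h2, h3⟩ := h (e z) (e a) (e t) (e.map_adj_iff.2 hza)
  refine ⟨f ∘ e, ?_, h2, h3⟩
  intro p q hpq hn1 hn2
  apply h1 _ _ (e.map_adj_iff.2 hpq)
  · simpa using hn1
  · simpa using hn2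

/-- No vertex has four distinct neighbors. -/
def Sub3 {U : Type} (K : SimpleGraph U) : Prop :=
  ∀ z a b c d, K.Adj z a → K.Adj z b → K.Adj z c → K.Adj z d →
    a ≠ b → c ≠ d → a = c ∨ a = d ∨ b = c ∨ b = d

lemma sub3_of_card (K : SimpleGraph (Fin 10)) [DecidableRel K.Adj]
    (h : ∀ z : Fin 10, (Finset.univ.filter (fun a => K.Adj z a)).card ≤ 3) : Sub3 K := by
  intro z a b c d ha hb hc hd hab hcd
  by_contra hn
  push Not at hn
  obtain ⟨h1, h2, h3, h4⟩ := hn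
  have hs : ({a, b, c, d} : Finset (Fin 10)) ⊆ Finset.univ.filter (fun a => K.Adj z a) := by
    intro i hi
    simp only [Finset.mem_insert, Finset.mem_singleton] at hi
    simp only [Finset.mem_filter, Finset.mem_univ, true_and]
    rcases hi with rfl | rfl | rfl | rfl <;> assumption
  have := Finset.card_le_card hs
  rw [Finset.card_insert_of_notMem (by simp [hab, h1, h2]),
    Finset.card_insert_of_notMem (by simp [h3, h4]),
    Finset.card_insert_of_notMem (by simp [hcd]), Finset.card_singleton] at this
  have := h z
  omega

lemma Sub3.of_iso {U W : Type} {K : SimpleGraph U} {H : SimpleGraph W} (e : K ≃g H) (h : Sub3 H) :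
    Sub3 K := by
  intro z a b c d ha hb hc hd hab hcd
  have := h (e z) (e a) (e b) (e c) (e d) (e.map_adj_iff.2 ha) (e.map_adj_iff.2 hb)
    (e.map_adj_iff.2 hc) (e.map_adj_iff.2 hd) (by simpa using hab) (by simpa using hcd)
  simpa using this


/-! ### The potential method -/

lemma c5_subsets : ∀ T : Finset (Fin 5), T.Nonempty →
    4 * ((T ×ˢ T).filter (fun p => (cycleGraph 5).Adj p.1 p.2)).card + 10 ≤ 10 * T.card := by
  decide +kernel

lemma step {V : Type} [Fintype V] {G : SimpleGraph V} (h : SmallestCex G) (F : Finset V)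
    (hF : F ≠ Finset.univ) (hF6 : 6 ≤ F.card) :
    ∃ F' : Finset V, F ⊂ F' ∧ (dpot G F' ≤ dpot G F - 6 ∨
      (dpot G F' ≤ dpot G F - 4 ∧ F'.card ≤ F.card + 2)) := by
  classical
  obtain ⟨w0, hw0⟩ : ∃ w, w ∉ F := by
    by_contra hn
    push Not at hn
    exact hF (Finset.eq_univ_of_forall hn)
  obtain ⟨φ, hφ⟩ := crit_col_missing h.1 (F : Set V) w0 (by simpa using hw0)
  let π : V → {a // a ∉ F} ⊕ Fin 5 := fun a => if ha : a ∈ F then Sum.inr (φ a) else Sum.inl ⟨a, ha⟩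
  have π_in : ∀ a, a ∈ F → π a = Sum.inr (φ a) := fun a ha => by simp [π, ha]
  have π_out : ∀ a (ha : a ∉ F), π a = Sum.inl ⟨a, ha⟩ := fun a ha => by simp [π, ha]
  let G1 : SimpleGraph ({a // a ∉ F} ⊕ Fin 5) :=
    { Adj := fun p q => ∃ a b, π a = p ∧ π b = q ∧ G.Adj a b
      symm := ⟨by
        rintro p q ⟨a, b, ha, hb, hab⟩
        exact ⟨b, a, hb, ha, hab.symm⟩⟩
      loopless := ⟨by
        rintro p ⟨a, b, ha, hb, hab⟩
        by_cases haF : a ∈ F <;> by_cases hbF : b ∈ F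
        · rw [π_in a haF] at ha
          rw [π_in b hbF, ← ha] at hb
          have := hφ a haF b hbF hab
          rw [Sum.inr.inj hb] at this
          exact this.ne rfl
        · rw [π_in a haF] at ha
          rw [π_out b hbF, ← ha] at hb
          cases hb
        · rw [π_out a haF] at ha
          rw [π_in b hbF, ← ha] at hb
          cases hb
        · rw [π_out a haF] at ha
          rw [π_out b hbF, ← ha] at hb
          have := congrArg Subtype.val (Sum.inl.inj hb)
          exact hab.ne this.symm⟩ }
  have hG1 : ¬ ∃ f, IsCol G1 f := by
    rintro ⟨f, hf⟩
    exact (noncol_iff G).1 h.1.1 ⟨f ∘ π, fun a b hab => hf _ _ ⟨a, b, rfl, rfl, hab⟩⟩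
  obtain ⟨m, K, j, hK, hj, hadj⟩ := exists_critical G1 hG1
  have hm : m < Fintype.card V := by
    have h1 := Fintype.card_le_of_injective j hj
    have h2 : Fintype.card {a // a ∉ F} = Fintype.card V - F.card := by simp
    have h3 := Finset.card_le_univ F
    rw [Fintype.card_fin, Fintype.card_sum, h2, Fintype.card_fin] at h1
    omega
  -- lifting of edges
  have hlift : ∀ p : Fin m × Fin m, ∃ q : V × V, K.Adj p.1 p.2 →
      π q.1 = j p.1 ∧ π q.2 = j p.2 ∧ G.Adj q.1 q.2 := by
    intro p
    by_cases hp : K.Adj p.1 p.2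
    · obtain ⟨a, b, h1, h2, h3⟩ := hadj _ _ hp
      exact ⟨(a, b), fun _ => ⟨h1, h2, h3⟩⟩
    · exact ⟨(w0, w0), fun hh => absurd hh hp⟩
  choose ℓ hℓ using hlift
  let X : Finset (Fin m) := Finset.univ.filter (fun i => (j i).isRight = true)
  let Y : Finset (Fin m) := Finset.univ.filter (fun i => ¬ (j i).isRight = true)
  have hXY : X.card + Y.card = m := by
    have := Finset.card_filter_add_card_filter_not (s := (Finset.univ : Finset (Fin m)))
      (fun i => (j i).isRight = true)
    simpa [X, Y] using this
  let g : {a // a ∉ F} ⊕ Fin 5 → V := Sum.elim Subtype.val (fun _ => w0)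
  let c : {a // a ∉ F} ⊕ Fin 5 → Fin 5 := Sum.elim (fun _ => 0) id
  have hX : ∀ i, i ∈ X → j i = Sum.inr (c (j i)) := by
    intro i hi
    simp only [X, Finset.mem_filter, Finset.mem_univ, true_and] at hi
    rcases hji : j i with a | a
    · simp [hji] at hi
    · rfl
  have hY : ∀ i, i ∈ Y → ∃ ha : g (j i) ∉ F, j i = Sum.inl ⟨g (j i), ha⟩ := by
    intro i hi
    simp only [Y, Finset.mem_filter, Finset.mem_univ, true_and] at hi
    rcases hji : j i with a | a
    · exact ⟨a.2, rfl⟩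
    · simp [hji] at hi
  have hXorY : ∀ i, i ∈ X ∨ i ∈ Y := by
    intro i
    simp only [X, Y, Finset.mem_filter, Finset.mem_univ, true_and]
    exact em _
  have liftX : ∀ i ∈ X, ∀ a, π a = j i → a ∈ F ∧ φ a = c (j i) := by
    intro i hi a ha
    rw [hX i hi] at ha
    by_cases haF : a ∈ F
    · rw [π_in a haF] at ha
      exact ⟨haF, Sum.inr.inj ha⟩
    · rw [π_out a haF] at ha
      cases ha
  have liftY : ∀ i ∈ Y, ∀ a, π a = j i → a ∉ F ∧ a = g (j i) := by
    intro i hi a ha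
    obtain ⟨hg, hji⟩ := hY i hi
    rw [hji] at ha
    by_cases haF : a ∈ F
    · rw [π_in a haF] at ha
      cases ha
    · rw [π_out a haF] at ha
      exact ⟨haF, congrArg Subtype.val (Sum.inl.inj ha)⟩
  have colX : ∀ i ∈ X, ∀ k ∈ X, K.Adj i k → (cycleGraph 5).Adj (c (j i)) (c (j k)) := by
    intro i hi k hk hik
    obtain ⟨h1, h2, h3⟩ := hℓ (i, k) hik
    obtain ⟨h4, h5⟩ := liftX i hi _ h1
    obtain ⟨h6, h7⟩ := liftX k hk _ h2
    rw [← h5, ← h7]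
    exact hφ _ h4 _ h6 h3
  have hXne : X.Nonempty := by
    by_contra hn
    rw [Finset.not_nonempty_iff_eq_empty] at hn
    have hall : ∀ i, i ∈ Y := fun i => (hXorY i).resolve_left (by simp [hn])
    obtain ⟨w, hw⟩ : F.Nonempty := Finset.card_pos.1 (by omega)
    refine no_hom_missing h.1 hK (fun i => g (j i)) w ?_ ?_
    · rintro i rfl
      exact (hY i (hall i)).1 hw
    · intro i k hik
      obtain ⟨h1, h2, h3⟩ := hℓ (i, k) hik
      have h4 := (liftY i (hall i) _ h1).2
      have h5 := (liftY k (hall k) _ h2).2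
      rw [← h4, ← h5]
      exact h3
  have hYne : Y.Nonempty := by
    by_contra hn
    rw [Finset.not_nonempty_iff_eq_empty] at hn
    have hall : ∀ i, i ∈ X := fun i => (hXorY i).resolve_right (by simp [hn])
    exact (noncol_iff K).1 hK.1 ⟨fun i => c (j i), fun i k hik => colX i (hall i) k (hall k) hik⟩
  let F' : Finset V := F ∪ Y.image (fun i => g (j i))
  have hF'card : F'.card ≤ F.card + Y.card :=
    (Finset.card_union_le _ _).trans (Nat.add_le_add_left Finset.card_image_le _)
  have hlF' : ∀ i a, π a = j i → a ∈ F' := by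
    intro i a ha
    rcases hXorY i with hi | hi
    · exact Finset.mem_union_left _ (liftX i hi a ha).1
    · apply Finset.mem_union_right
      rw [(liftY i hi a ha).2]
      exact Finset.mem_image_of_mem _ hi
  -- edges
  have hprsX : prs K X ⊆ prs K Finset.univ := by
    intro p hp
    have := mem_prs.1 hp
    exact mem_prs.2 ⟨Finset.mem_univ _, Finset.mem_univ _, this.2.2⟩
  have hinj : Set.InjOn ℓ ((prs K Finset.univ \ prs K X : Finset _) : Set (Fin m × Fin m)) := by
    intro p hp q hq hpq
    have hp' := (mem_prs.1 (Finset.mem_sdiff.1 hp).1).2.2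
    have hq' := (mem_prs.1 (Finset.mem_sdiff.1 hq).1).2.2
    obtain ⟨h1, h2, -⟩ := hℓ p hp'
    obtain ⟨h3, h4, -⟩ := hℓ q hq'
    rw [hpq] at h1 h2
    exact Prod.ext (hj (h1.symm.trans h3)) (hj (h2.symm.trans h4))
  have hdisj : Disjoint (prs G F) ((prs K Finset.univ \ prs K X).image ℓ) := by
    rw [Finset.disjoint_left]
    intro q hq hq'
    obtain ⟨p, hp, rfl⟩ := Finset.mem_image.1 hq'
    obtain ⟨hp1, hp2⟩ := Finset.mem_sdiff.1 hp
    have hp3 := (mem_prs.1 hp1).2.2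
    obtain ⟨h1, h2, h3⟩ := hℓ p hp3
    obtain ⟨h4, h5, -⟩ := mem_prs.1 hq
    apply hp2
    refine mem_prs.2 ⟨?_, ?_, hp3⟩
    · exact (hXorY p.1).resolve_right (fun hy => (liftY _ hy _ h1).1 h4)
    · exact (hXorY p.2).resolve_right (fun hy => (liftY _ hy _ h2).1 h5)
  have hsub : prs G F ∪ (prs K Finset.univ \ prs K X).image ℓ ⊆ prs G F' := by
    intro q hq
    rcases Finset.mem_union.1 hq with hq | hq
    · obtain ⟨h1, h2, h3⟩ := mem_prs.1 hq
      exact mem_prs.2 ⟨Finset.mem_union_left _ h1, Finset.mem_union_left _ h2, h3⟩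
    · obtain ⟨p, hp, rfl⟩ := Finset.mem_image.1 hq
      obtain ⟨h1, h2, h3⟩ := hℓ p (mem_prs.1 (Finset.mem_sdiff.1 hp).1).2.2
      exact mem_prs.2 ⟨hlF' _ _ h1, hlF' _ _ h2, h3⟩
  have hcard := Finset.card_le_card hsub
  rw [Finset.card_union_of_disjoint hdisj, Finset.card_image_of_injOn hinj,
    Finset.card_sdiff_of_subset hprsX] at hcard
  have hcard2 := Finset.card_le_card hprsX
  -- the part inside the 5-cycle
  have hcinj : Set.InjOn (fun i => c (j i)) (X : Set (Fin m)) := by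
    intro i hi k hk hik
    apply hj
    rw [hX i hi, hX k hk]
    exact congrArg Sum.inr hik
  have h5 := c5_subsets (X.image (fun i => c (j i))) (hXne.image _)
  rw [Finset.card_image_of_injOn hcinj] at h5
  have h6 : (prs K X).card ≤ (((X.image (fun i => c (j i))) ×ˢ (X.image (fun i => c (j i)))).filter
      (fun p => (cycleGraph 5).Adj p.1 p.2)).card := by
    apply Finset.card_le_card_of_injOn (fun p => (c (j p.1), c (j p.2)))
    · intro p hp
      obtain ⟨h1, h2, h3⟩ := mem_prs.1 hp
      simp only [Finset.coe_filter, Set.mem_ofPred_eq, Finset.mem_product]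
      exact ⟨⟨Finset.mem_image_of_mem _ h1, Finset.mem_image_of_mem _ h2⟩, colX _ h1 _ h2 h3⟩
    · intro p hp q hq hpq
      obtain ⟨h1, h2, h3⟩ := mem_prs.1 hp
      obtain ⟨h1', h2', h3'⟩ := mem_prs.1 hq
      simp only [Prod.mk.injEq] at hpq
      exact Prod.ext (hcinj h1 h1' hpq.1) (hcinj h2 h2' hpq.2)
  have hpotK := dpot_univ K
  rw [dpot, Finset.card_univ, Fintype.card_fin] at hpotK
  have hXpos := hXne.card_pos
  refine ⟨F', ?_, ?_⟩
  · rw [Finset.ssubset_iff_of_subset Finset.subset_union_left]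
    obtain ⟨i, hi⟩ := hYne
    exact ⟨g (j i), Finset.mem_union_right _ (Finset.mem_image_of_mem _ hi), (hY i hi).1⟩
  · have key : dpot G F' ≤ dpot G F + 2 * pot K - 10 := by
      rw [dpot, dpot]
      omega
    rcases small_cases h K hK hm with ⟨⟨e⟩, hp⟩ | ⟨-, hp⟩ | hp
    · right
      have hm3 : m = 3 := by simpa using Fintype.card_congr e.toEquiv
      constructor <;> omega
    · left; omega
    · left; omega

lemma dpot_ge {V : Type} [Fintype V] {G : SimpleGraph V} (h : SmallestCex G) (F : Finset V)
    (hF : F ≠ Finset.univ) (hF6 : 6 ≤ F.card) : 8 ≤ dpot G F := by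
  induction hk : Fintype.card V - F.card using Nat.strong_induction_on generalizing F with
  | _ k ih =>
    by_contra hlt
    obtain ⟨F', hsub, hF'⟩ := step h F hF hF6
    have h1 := Finset.card_lt_card hsub
    have h2 := Finset.card_le_univ F'
    have h3 : dpot G F' < 4 := by omega
    by_cases hu : F' = Finset.univ
    · rw [hu, dpot_univ] at h3
      have := h.2.2.2.2.1
      omega
    · have := ih (Fintype.card V - F'.card) (by omega) F' hu (by omega) rfl
      omega

/-! ### Coloring extensions -/

lemma c5_fact1 : ∀ a z : Fin 5, (a - z = 2 ∨ a - z = 3) →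
    (cycleGraph 5).Adj (4 * a + 2 * z) a ∧ (cycleGraph 5).Adj (4 * a + 2 * z) (2 * a - z) ∧
    (cycleGraph 5).Adj z (2 * a - z) := by
  decide +kernel

lemma c5_fact2 : ∀ p q : Fin 5, p ≠ q → ∃ r s, (cycleGraph 5).Adj p r ∧ (cycleGraph 5).Adj r s ∧
    (cycleGraph 5).Adj s q := by
  decide +kernel

lemma c5_fact3 : ∀ c p : Fin 5, ∃ d, (cycleGraph 5).Adj c d ∧ d ≠ p := by
  decide +kernel

lemma c5_triangle : ∀ a b c : Fin 5, (cycleGraph 5).Adj a b → (cycleGraph 5).Adj b c →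
    (cycleGraph 5).Adj a c → False := by
  decide +kernel

lemma no_triangle {V : Type} {G : SimpleGraph V} (h : Critical52 G) (a b c w : V)
    (ha : a ≠ w) (hb : b ≠ w) (hc : c ≠ w) (hab : G.Adj a b) (hbc : G.Adj b c) (hac : G.Adj a c) :
    False := by
  obtain ⟨f, hf⟩ := crit_col_missing h {a | a ≠ w} w (by simp)
  exact c5_triangle _ _ _ (hf a ha b hb hab) (hf b hb c hc hbc) (hf a ha c hc hac)

/-- Extending a coloring to the vertices `v`, `v1`, `x`. -/
lemma ext_col {V : Type} {G : SimpleGraph V} {v v1 x y v2 v3 : V}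
    (hv1 : v ≠ v1) (hvx : v ≠ x) (h1x : v1 ≠ x)
    (hNv : ∀ b, G.Adj v b → b = v1 ∨ b = v2 ∨ b = v3)
    (hNv1 : ∀ b, G.Adj v1 b → b = v ∨ b = x)
    (hNx : ∀ b, G.Adj x b → b = v1 ∨ b = y)
    (hy : y ≠ v ∧ y ≠ v1 ∧ y ≠ x) (h2 : v2 ≠ v ∧ v2 ≠ v1 ∧ v2 ≠ x) (h3 : v3 ≠ v ∧ v3 ≠ v1 ∧ v3 ≠ x)
    (f : V → Fin 5) (hf : ∀ a b, (a ≠ v ∧ a ≠ v1 ∧ a ≠ x) → (b ≠ v ∧ b ≠ v1 ∧ b ≠ x) → G.Adj a b →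
      (cycleGraph 5).Adj (f a) (f b))
    (d : Fin 5) (hd2 : (cycleGraph 5).Adj (f v2) d) (hd3 : (cycleGraph 5).Adj (f v3) d)
    (hdy : d ≠ f y) : ∃ f, IsCol G f := by
  classical
  obtain ⟨r, s, hr, hrs, hs⟩ := c5_fact2 d (f y) hdy
  let F : V → Fin 5 := fun a => if a = v then d else if a = v1 then r else if a = x then s else f a
  have Fv : F v = d := by simp [F]
  have Fv1 : F v1 = r := by simp [F, hv1.symm]
  have Fx : F x = s := by simp [F, hvx.symm, h1x.symm]
  have FU : ∀ a, (a ≠ v ∧ a ≠ v1 ∧ a ≠ x) → F a = f a := by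
    rintro a ⟨h1, h2, h3⟩; simp [F, h1, h2, h3]
  have cv : ∀ b, G.Adj v b → (cycleGraph 5).Adj (F v) (F b) := by
    intro b hb
    rcases hNv b hb with rfl | rfl | rfl
    · rw [Fv, Fv1]; exact hr
    · rw [Fv, FU _ h2]; exact hd2.symm
    · rw [Fv, FU _ h3]; exact hd3.symm
  have cv1 : ∀ b, G.Adj v1 b → (cycleGraph 5).Adj (F v1) (F b) := by
    intro b hb
    rcases hNv1 b hb with rfl | rfl
    · rw [Fv, Fv1]; exact hr.symm
    · rw [Fv1, Fx]; exact hrs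
  have cx : ∀ b, G.Adj x b → (cycleGraph 5).Adj (F x) (F b) := by
    intro b hb
    rcases hNx b hb with rfl | rfl
    · rw [Fv1, Fx]; exact hrs.symm
    · rw [Fx, FU _ hy]; exact hs
  have cU : ∀ a, ¬ (a ≠ v ∧ a ≠ v1 ∧ a ≠ x) → ∀ b, G.Adj a b → (cycleGraph 5).Adj (F a) (F b) := by
    intro a ha
    by_cases e1 : a = v
    · subst e1; exact cv
    by_cases e2 : a = v1
    · subst e2; exact cv1
    by_cases e3 : a = x
    · subst e3; exact cx
    exact absurd ⟨e1, e2, e3⟩ ha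
  refine ⟨F, fun a b hab => ?_⟩
  by_cases ha : (a ≠ v ∧ a ≠ v1 ∧ a ≠ x)
  · by_cases hb : (b ≠ v ∧ b ≠ v1 ∧ b ≠ x)
    · rw [FU a ha, FU b hb]; exact hf a b ha hb hab
    · exact (cU b hb a hab.symm).symm
  · exact cU a ha b hab

/-- The coloring of a graph obtained from an exceptional graph by splitting a vertex. -/
lemma final_col {V : Type} {G : SimpleGraph V} {v v1 x y u w : V}
    (hv1 : v ≠ v1) (hvx : v ≠ x) (h1x : v1 ≠ x)
    (hNv : ∀ b, G.Adj v b → b = v1 ∨ b = u ∨ b = w)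
    (hNv1 : ∀ b, G.Adj v1 b → b = v ∨ b = x)
    (hNx : ∀ b, G.Adj x b → b = v1 ∨ b = y)
    (hy : y ≠ v ∧ y ≠ v1 ∧ y ≠ x) (hu : u ≠ v ∧ u ≠ v1 ∧ u ≠ x) (hw : w ≠ v ∧ w ≠ v1 ∧ w ≠ x)
    (huw : u ≠ w) {m : ℕ} {K : SimpleGraph (Fin m)} (hK : Flex K) (r : V → Fin m) (z a : Fin m)
    (hr : ∀ a b, (a ≠ v ∧ a ≠ v1 ∧ a ≠ x) → (b ≠ v ∧ b ≠ v1 ∧ b ≠ x) → G.Adj a b →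
      K.Adj (r a) (r b))
    (hrw : r w = z) (hrz : ∀ b, (b ≠ v ∧ b ≠ v1 ∧ b ≠ x) → r b = z → b = u ∨ b = w)
    (hua : ∀ b, (b ≠ v ∧ b ≠ v1 ∧ b ≠ x) → G.Adj u b → r b = a)
    (hwa : ∀ b, (b ≠ v ∧ b ≠ v1 ∧ b ≠ x) → G.Adj w b → r b ≠ a)
    (hza : K.Adj z a) : ∃ f, IsCol G f := by
  classical
  obtain ⟨f, hf, hfa, hft⟩ := hK z a (r y) hza
  obtain ⟨h1, h2, h3⟩ := c5_fact1 _ _ hfa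
  let F : V → Fin 5 := fun b => if b = u then 4 * f a + 2 * f z else f (r b)
  have Fu : F u = 4 * f a + 2 * f z := by simp [F]
  have Fo : ∀ b, b ≠ u → F b = f (r b) := fun b hb => by simp [F, hb]
  refine ext_col hv1 hvx h1x hNv hNv1 hNx hy hu hw F ?_ (2 * f a - f z) ?_ ?_ ?_
  · intro p q hp hq hpq
    by_cases hpu : p = u
    · subst hpu
      rw [Fu, Fo q hpq.ne', hua q hq hpq]
      exact h1
    by_cases hqu : q = u
    · subst hqu
      rw [Fu, Fo p hpq.ne, hua p hp hpq.symm]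
      exact h1.symm
    rw [Fo p hpu, Fo q hqu]
    apply hf _ _ (hr p q hp hq hpq)
    · rintro ⟨e1, e2⟩
      have := (hrz p hp e1).resolve_left hpu
      subst this
      exact hwa q hq hpq e2
    · rintro ⟨e1, e2⟩
      have := (hrz q hq e2).resolve_left hqu
      subst this
      exact hwa p hp hpq.symm e1
  · rw [Fu]; exact h2
  · rw [Fo w huw.symm, hrw]; exact h3
  · by_cases hyu : y = u
    · rw [hyu, Fu]; exact h2.ne'
    · rw [Fo y hyu]; exact hft.symm

lemma five_cycle {V : Type} {G : SimpleGraph V} {v v2 v3 p q : V}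
    (h1 : G.Adj v v2) (h2 : G.Adj v v3) (h3 : G.Adj v2 p) (h4 : G.Adj p q) (h5 : G.Adj q v3)
    (h23 : v2 ≠ v3) (hpv : p ≠ v) (hqv : q ≠ v) (hp3 : p ≠ v3) (hq2 : q ≠ v2) :
    ∃ (w : V) (c : G.Walk w w), c.IsCycle ∧ c.length = 5 ∧
      s(v2, v) ∈ c.edges ∧ s(v, v3) ∈ c.edges := by
  refine ⟨v2, .cons h1.symm (.cons h2 (.cons h5.symm (.cons h4.symm (.cons h3.symm .nil)))),
    ?_, by simp, by simp, by simp⟩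
  rw [Walk.cons_isCycle_iff]
  have := h1.ne
  have := h2.ne
  have := h3.ne
  have := h4.ne
  have := h5.ne
  constructor
  · simp [Walk.cons_isPath_iff]
    grind
  · simp
    grind

/-- In a smallest counterexample, let `v` have degree 3 and be an end of a
2-string `v v1 x y`, and let `v2`, `v3` be the other two neighbors of `v`. Then the path
`v2 v v3` is contained in a 5-cycle. -/
theorem smallestCex_opposite_five_cycle {V : Type} [Fintype V] (G : SimpleGraph V)
    (h : SmallestCex G) (v v1 x y v2 v3 : V)
    (hnodup : [v, v1, x, y].Nodup)
    (ha1 : G.Adj v v1) (ha2 : G.Adj v1 x) (ha3 : G.Adj x y)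
    (hdv : deg G v = 3) (hdv1 : deg G v1 = 2) (hdx : deg G x = 2) (hdy : 3 ≤ deg G y)
    (hv2 : G.Adj v v2) (hv3 : G.Adj v v3)
    (hv2v1 : v2 ≠ v1) (hv3v1 : v3 ≠ v1) (hv2v3 : v2 ≠ v3) :
    ∃ (w : V) (c : G.Walk w w), c.IsCycle ∧ c.length = 5 ∧
      s(v2, v) ∈ c.edges ∧ s(v, v3) ∈ c.edges := by
  classical
  have hcrit := h.1
  have hncol := (noncol_iff G).1 hcrit.1
  simp only [List.nodup_cons, List.mem_cons, List.not_mem_nil, or_false, not_or] at hnodup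
  obtain ⟨⟨nvv1, nvx, nvy⟩, ⟨nv1x, nv1y⟩, nxy, -⟩ := hnodup
  -- neighborhoods
  have hNv : ∀ b, G.Adj v b → b = v1 ∨ b = v2 ∨ b = v3 := by
    have hs : ({v1, v2, v3} : Set V) = G.neighborSet v := by
      apply Set.eq_of_subset_of_ncard_le _ _ (Set.toFinite _)
      · rintro b (rfl | rfl | rfl) <;> assumption
      · rw [Set.ncard_eq_three.2 ⟨v1, v2, v3, hv2v1.symm, hv3v1.symm, hv2v3, rfl⟩]
        exact hdv.le
    intro b hb
    have : b ∈ ({v1, v2, v3} : Set V) := by rw [hs]; exact hb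
    simpa using this
  have hNv1 : ∀ b, G.Adj v1 b → b = v ∨ b = x := by
    have hs : ({v, x} : Set V) = G.neighborSet v1 := by
      apply Set.eq_of_subset_of_ncard_le _ _ (Set.toFinite _)
      · rintro b (rfl | rfl)
        · exact ha1.symm
        · exact ha2
      · rw [Set.ncard_pair nvx]
        exact hdv1.le
    intro b hb
    have : b ∈ ({v, x} : Set V) := by rw [hs]; exact hb
    simpa using this
  have hNx : ∀ b, G.Adj x b → b = v1 ∨ b = y := by
    have hs : ({v1, y} : Set V) = G.neighborSet x := by
      apply Set.eq_of_subset_of_ncard_le _ _ (Set.toFinite _)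
      · rintro b (rfl | rfl)
        · exact ha2.symm
        · exact ha3
      · rw [Set.ncard_pair nv1y]
        exact hdx.le
    intro b hb
    have : b ∈ ({v1, y} : Set V) := by rw [hs]; exact hb
    simpa using this
  have hvx : ¬ G.Adj v x := by
    intro hh
    rcases hNx v hh.symm with e | e
    · exact nvv1 e
    · exact nvy e
  have Uy : y ≠ v ∧ y ≠ v1 ∧ y ≠ x := ⟨Ne.symm nvy, Ne.symm nv1y, Ne.symm nxy⟩
  have U2 : v2 ≠ v ∧ v2 ≠ v1 ∧ v2 ≠ x := ⟨hv2.ne', hv2v1, by rintro rfl; exact hvx hv2⟩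
  have U3 : v3 ≠ v ∧ v3 ≠ v1 ∧ v3 ≠ x := ⟨hv3.ne', hv3v1, by rintro rfl; exact hvx hv3⟩
  have h23 : ¬ G.Adj v2 v3 := fun hh => no_triangle hcrit v v2 v3 v1 nvv1 hv2v1 hv3v1 hv2 hh hv3
  -- identification of `v2` and `v3`
  let π : V → V := fun a => if a = v3 then v2 else a
  have π3 : π v3 = v2 := by simp [π]
  have πo : ∀ a, a ≠ v3 → π a = a := fun a ha => by simp [π, ha]
  have πU : ∀ a, (a ≠ v ∧ a ≠ v1 ∧ a ≠ x) → (π a ≠ v ∧ π a ≠ v1 ∧ π a ≠ x) ∧ π a ≠ v3 := by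
    intro a ha
    by_cases e : a = v3
    · rw [e, π3]; exact ⟨U2, hv2v3⟩
    · rw [πo a e]; exact ⟨ha, e⟩
  let G1 : SimpleGraph {a : V // (a ≠ v ∧ a ≠ v1 ∧ a ≠ x) ∧ a ≠ v3} :=
    { Adj := fun p q => ∃ a b, (a ≠ v ∧ a ≠ v1 ∧ a ≠ x) ∧ (b ≠ v ∧ b ≠ v1 ∧ b ≠ x) ∧
        π a = p.1 ∧ π b = q.1 ∧ G.Adj a b
      symm := ⟨by
        rintro p q ⟨a, b, ha, hb, h1, h2, hab⟩
        exact ⟨b, a, hb, ha, h2, h1, hab.symm⟩⟩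
      loopless := ⟨by
        rintro p ⟨a, b, ha, hb, h1, h2, hab⟩
        by_cases ea : a = v3 <;> by_cases eb : b = v3
        · exact hab.ne (ea.trans eb.symm)
        · rw [ea, π3] at h1
          rw [πo b eb, ← h1] at h2
          rw [ea, h2] at hab
          exact h23 hab.symm
        · rw [eb, π3] at h2
          rw [πo a ea, ← h2] at h1
          rw [eb, h1] at hab
          exact h23 hab
        · rw [πo a ea] at h1
          rw [πo b eb] at h2
          exact hab.ne (h1.trans h2.symm)⟩ }
  have hG1 : ¬ ∃ f, IsCol G1 f := by
    rintro ⟨f, hf⟩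
    apply hncol
    let F : V → Fin 5 := fun a =>
      if ha : (π a ≠ v ∧ π a ≠ v1 ∧ π a ≠ x) ∧ π a ≠ v3 then f ⟨π a, ha⟩ else 0
    have FU : ∀ a (ha : a ≠ v ∧ a ≠ v1 ∧ a ≠ x), F a = f ⟨π a, πU a ha⟩ := by
      intro a ha
      exact dif_pos (πU a ha)
    obtain ⟨d, hd, hdy⟩ := c5_fact3 (F v2) (F y)
    have F23 : F v3 = F v2 := by
      simp only [F, π3, πo v2 hv2v3]
    refine ext_col nvv1 nvx nv1x hNv hNv1 hNx Uy U2 U3 F ?_ d hd (by rw [F23]; exact hd) hdy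
    intro a b ha hb hab
    rw [FU a ha, FU b hb]
    exact hf _ _ ⟨a, b, ha, hb, rfl, rfl, hab⟩
  obtain ⟨m, K, j, hK, hj, hadj⟩ := exists_critical G1 hG1
  have hm : m < Fintype.card V := by
    have h1 := Fintype.card_le_of_injective j hj
    have h2 : Fintype.card {a : V // (a ≠ v ∧ a ≠ v1 ∧ a ≠ x) ∧ a ≠ v3} < Fintype.card V :=
      Fintype.card_subtype_lt (x := v) (by simp)
    rw [Fintype.card_fin] at h1
    omega
  let J : Fin m → V := fun i => (j i).1
  have hJ : Function.Injective J := Subtype.val_injective.comp hj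
  have JU : ∀ i, J i ≠ v ∧ J i ≠ v1 ∧ J i ≠ x := fun i => (j i).2.1
  have J3 : ∀ i, J i ≠ v3 := fun i => (j i).2.2
  have hlift : ∀ p : Fin m × Fin m, ∃ q : V × V, K.Adj p.1 p.2 →
      (q.1 ≠ v ∧ q.1 ≠ v1 ∧ q.1 ≠ x) ∧ (q.2 ≠ v ∧ q.2 ≠ v1 ∧ q.2 ≠ x) ∧
      π q.1 = J p.1 ∧ π q.2 = J p.2 ∧ G.Adj q.1 q.2 := by
    intro p
    by_cases hp : K.Adj p.1 p.2
    · obtain ⟨a, b, h1, h2, h3, h4, h5⟩ := hadj _ _ hp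
      exact ⟨(a, b), fun _ => ⟨h1, h2, h3, h4, h5⟩⟩
    · exact ⟨(v, v), fun hh => absurd hh hp⟩
  choose ℓ hℓ using hlift
  have lift_cases : ∀ a b, π a = b → a = b ∨ (a = v3 ∧ b = v2) := by
    intro a b hab
    by_cases e : a = v3
    · right; rw [e, π3] at hab; exact ⟨e, hab.symm⟩
    · left; rw [πo a e] at hab; exact hab
  -- both `v2` and `v3` are used
  have ex3 : ∃ b, (b ≠ v ∧ b ≠ v1 ∧ b ≠ x) ∧ G.Adj v3 b := by
    by_contra hn
    push Not at hn
    refine no_hom_missing hcrit hK J v (fun i => (JU i).1) ?_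
    intro i k hik
    obtain ⟨h1, h2, h3, h4, h5⟩ := hℓ (i, k) hik
    rcases lift_cases _ _ h3 with e | ⟨e, -⟩
    · rcases lift_cases _ _ h4 with e' | ⟨e', -⟩
      · rw [e, e'] at h5; exact h5
      · rw [e'] at h5
        exact absurd h5.symm (hn _ h1)
    · rw [e] at h5
      exact absurd h5 (hn _ h2)
  have hz : ∃ z, J z = v2 := by
    by_contra hn
    push Not at hn
    refine no_hom_missing hcrit hK J v (fun i => (JU i).1) ?_
    intro i k hik
    obtain ⟨h1, h2, h3, h4, h5⟩ := hℓ (i, k) hik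
    rcases lift_cases _ _ h3 with e | ⟨-, e⟩
    · rcases lift_cases _ _ h4 with e' | ⟨-, e'⟩
      · rw [e, e'] at h5; exact h5
      · exact absurd e' (hn _)
    · exact absurd e (hn _)
  obtain ⟨z, hz⟩ := hz
  have ex2 : ∃ b, (b ≠ v ∧ b ≠ v1 ∧ b ≠ x) ∧ G.Adj v2 b := by
    by_contra hn
    push Not at hn
    refine no_hom_missing hcrit hK (fun i => if J i = v2 then v3 else J i) v ?_ ?_
    · intro i
      split_ifs
      · exact U3.1
      · exact (JU i).1
    intro i k hik
    obtain ⟨h1, h2, h3, h4, h5⟩ := hℓ (i, k) hik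
    have n1 : (ℓ (i, k)).1 ≠ v2 := fun e => hn _ h2 (e ▸ h5)
    have n2 : (ℓ (i, k)).2 ≠ v2 := fun e => hn _ h1 (e ▸ h5.symm)
    have e1 : (if J i = v2 then v3 else J i) = (ℓ (i, k)).1 := by
      rcases lift_cases _ _ h3 with e | ⟨e, e'⟩
      · rw [if_neg (by rw [← e]; exact n1)]; exact e.symm
      · rw [if_pos e', e]
    have e2 : (if J k = v2 then v3 else J k) = (ℓ (i, k)).2 := by
      rcases lift_cases _ _ h4 with e | ⟨e, e'⟩
      · rw [if_neg (by rw [← e]; exact n2)]; exact e.symm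
      · rw [if_pos e', e]
    rw [e1, e2]
    exact h5
  -- edges of `K`
  have edge_oo : ∀ i k, i ≠ z → k ≠ z → K.Adj i k → G.Adj (J i) (J k) := by
    intro i k hi hk hik
    obtain ⟨h1, h2, h3, h4, h5⟩ := hℓ (i, k) hik
    rcases lift_cases _ _ h3 with e | ⟨-, e⟩
    · rcases lift_cases _ _ h4 with e' | ⟨-, e'⟩
      · rw [e, e'] at h5; exact h5
      · exact absurd (hJ (e'.trans hz.symm)) hk
    · exact absurd (hJ (e.trans hz.symm)) hi
  have edge_zo : ∀ k, k ≠ z → K.Adj z k → G.Adj v2 (J k) ∨ G.Adj v3 (J k) := by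
    intro k hk hik
    obtain ⟨h1, h2, h3, h4, h5⟩ := hℓ (z, k) hik
    have e' : (ℓ (z, k)).2 = J k := by
      rcases lift_cases _ _ h4 with e' | ⟨-, e'⟩
      · exact e'
      · exact absurd (hJ (e'.trans hz.symm)) hk
    rw [e'] at h5
    rcases lift_cases _ _ h3 with e | ⟨e, -⟩
    · left; rw [e] at h5; rw [← hz]; exact h5
    · right; rw [e] at h5; exact h5
  have hcases := small_cases h K hK hm
  rcases hcases with ⟨⟨e⟩, -⟩ | hrest
  · -- the triangle case gives the 5-cycle
    have hcomplete : ∀ i k, i ≠ k → K.Adj i k := by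
      intro i k hik
      rw [← e.map_adj_iff]
      have h3 : ∀ a b : Fin 3, a ≠ b → (cycleGraph 3).Adj a b := by decide
      exact h3 _ _ (by simpa using hik)
    have hex : ∃ i k, i ≠ z ∧ k ≠ z ∧ i ≠ k := by
      have h3 : ∀ a : Fin 3, ∃ b c, b ≠ a ∧ c ≠ a ∧ b ≠ c := by decide
      obtain ⟨b, c, hb, hc, hbc⟩ := h3 (e z)
      refine ⟨e.symm b, e.symm c, ?_, ?_, ?_⟩
      · rintro rfl; exact hb (by simp)
      · rintro rfl; exact hc (by simp)
      · simpa using hbc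
    obtain ⟨i, k, hi, hk, hik⟩ := hex
    have e1 := edge_oo i k hi hk (hcomplete i k hik)
    have ne2 : ∀ i, i ≠ z → J i ≠ v2 := fun i hi hh => hi (hJ (hh.trans hz.symm))
    rcases edge_zo i hi (hcomplete z i hi.symm) with h1 | h1 <;>
      rcases edge_zo k hk (hcomplete z k hk.symm) with h2 | h2
    · exact (no_triangle hcrit v2 (J i) (J k) v U2.1 (JU i).1 (JU k).1 h1 e1 h2).elim
    · exact five_cycle hv2 hv3 h1 e1 h2.symm hv2v3 (JU i).1 (JU k).1 (J3 i) (ne2 k hk)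
    · exact five_cycle hv2 hv3 h2 e1.symm h1.symm hv2v3 (JU k).1 (JU i).1 (J3 k) (ne2 i hi)
    · exact (no_triangle hcrit v3 (J i) (J k) v U3.1 (JU i).1 (JU k).1 h1 e1 h2).elim
  exfalso
  have hpotK : pot K ≤ 2 := by
    rcases hrest with ⟨-, hp⟩ | hp <;> omega
  have hdK := dpot_univ K
  rw [dpot, Finset.card_univ, Fintype.card_fin] at hdK
  have hm4 : 4 ≤ m := by
    have hb : (prs K Finset.univ).card ≤ m * m - m := by
      have hs : prs K Finset.univ ⊆ (Finset.univ : Finset (Fin m)).offDiag := by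
        intro p hp
        simp only [Finset.mem_offDiag, Finset.mem_univ, true_and]
        exact (mem_prs.1 hp).2.2.ne
      have := Finset.card_le_card hs
      rwa [Finset.offDiag_card, Finset.card_univ, Fintype.card_fin] at this
    by_contra hlt
    have hpos : 0 < m := z.pos
    generalize (prs K Finset.univ).card = N at hb hdK
    have : m = 1 ∨ m = 2 ∨ m = 3 := by omega
    rcases this with e | e | e <;> rw [e] at hb <;> omega
  -- the lifted subgraph
  let S : Finset V := insert v3 (Finset.univ.image J)
  have hScard : S.card = m + 1 := by
    rw [Finset.card_insert_of_notMem, Finset.card_image_of_injective _ hJ, Finset.card_univ,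
      Fintype.card_fin]
    simp only [Finset.mem_image, Finset.mem_univ, true_and, not_exists]
    exact J3
  have SU : ∀ a ∈ S, a ≠ v ∧ a ≠ v1 ∧ a ≠ x := by
    intro a ha
    rcases Finset.mem_insert.1 ha with rfl | ha
    · exact U3
    · obtain ⟨i, -, rfl⟩ := Finset.mem_image.1 ha
      exact JU i
  have S3 : v3 ∈ S := Finset.mem_insert_self _ _
  have SJ : ∀ i, J i ∈ S := fun i =>
    Finset.mem_insert_of_mem (Finset.mem_image_of_mem _ (Finset.mem_univ _))
  have S2 : v2 ∈ S := hz ▸ SJ z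
  have liftS : ∀ a i, π a = J i → a ∈ S := by
    intro a i hai
    rcases lift_cases _ _ hai with e | ⟨e, -⟩
    · rw [e]; exact SJ i
    · rw [e]; exact S3
  have hinj : Set.InjOn ℓ (prs K Finset.univ : Set (Fin m × Fin m)) := by
    intro p hp q hq hpq
    obtain ⟨-, -, h1, h2, -⟩ := hℓ p (mem_prs.1 hp).2.2
    obtain ⟨-, -, h3, h4, -⟩ := hℓ q (mem_prs.1 hq).2.2
    rw [hpq] at h1 h2
    exact Prod.ext (hJ (h1.symm.trans h3)) (hJ (h2.symm.trans h4))
  have hsub : (prs K Finset.univ).image ℓ ⊆ prs G S := by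
    intro q hq
    obtain ⟨p, hp, rfl⟩ := Finset.mem_image.1 hq
    obtain ⟨-, -, h1, h2, h3⟩ := hℓ p (mem_prs.1 hp).2.2
    exact mem_prs.2 ⟨liftS _ _ h1, liftS _ _ h2, h3⟩
  have hcardS := Finset.card_le_card hsub
  rw [Finset.card_image_of_injOn hinj] at hcardS
  have hSv : v ∉ S := fun hh => (SU v hh).1 rfl
  have hH := dpot_insert (G := G) hSv {v2, v3}
    (by intro a ha; simp only [Finset.mem_insert, Finset.mem_singleton] at ha
        rcases ha with rfl | rfl <;> assumption)
    (by intro a ha; simp only [Finset.mem_insert, Finset.mem_singleton] at ha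
        rcases ha with rfl | rfl <;> assumption)
  rw [Finset.card_pair hv2v3] at hH
  have hdS : dpot G S = 10 * (m + 1) - 4 * (prs G S).card := by
    rw [dpot, hScard]; push_cast; ring
  have hHcard : (insert v S).card = m + 2 := by
    rw [Finset.card_insert_of_notMem hSv, hScard]
  have hG2 := h.2.2.2.2.1
  have hGu := dpot_univ G
  have n1 : v1 ∉ insert v S := by
    intro hh
    rcases Finset.mem_insert.1 hh with e | e
    · exact nvv1 e.symm
    · exact (SU _ e).2.1 rfl
  have nx : x ∉ insert v1 (insert v S) := by
    intro hh
    rcases Finset.mem_insert.1 hh with e | hh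
    · exact nv1x e.symm
    rcases Finset.mem_insert.1 hh with e | e
    · exact nvx e.symm
    · exact (SU _ e).2.2 rfl
  by_cases hyS : y ∈ S
  · have hH1 := dpot_insert (G := G) n1 {v} (by simp) (by simpa using ha1.symm)
    have hH2 := dpot_insert (G := G) nx {v1, y}
      (by intro a ha; simp only [Finset.mem_insert, Finset.mem_singleton] at ha
          rcases ha with rfl | rfl
          · simp
          · simp [hyS])
      (by intro a ha; simp only [Finset.mem_insert, Finset.mem_singleton] at ha
          rcases ha with rfl | rfl
          · exact ha2.symm
          · exact ha3)
    rw [Finset.card_pair nv1y] at hH2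
    rw [Finset.card_singleton] at hH1
    by_cases hu : insert x (insert v1 (insert v S)) = Finset.univ
    · rw [hu] at hH2
      have hEx : (Nonempty (K ≃g E1) ∨ Nonempty (K ≃g E2)) := by
        rcases hrest with ⟨he, -⟩ | hp
        · exact he
        · push_cast at hH hH1 hH2; omega
      have hFlex : Flex K := by
        rcases hEx with ⟨⟨e⟩⟩ | ⟨⟨e⟩⟩
        · exact flex_E1.of_iso e
        · exact flex_E2.of_iso e
      have hSub : Sub3 K := by
        rcases hEx with ⟨⟨e⟩⟩ | ⟨⟨e⟩⟩
        · exact (sub3_of_card E1 degree_E1).of_iso e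
        · exact (sub3_of_card E2 degree_E2).of_iso e
      have himage : (prs K Finset.univ).image ℓ = prs G S := by
        apply Finset.eq_of_subset_of_card_le hsub
        rw [Finset.card_image_of_injOn hinj]
        push_cast at hH hH1 hH2
        omega
      have US : ∀ a, (a ≠ v ∧ a ≠ v1 ∧ a ≠ x) → a ∈ S := by
        intro a ha
        have : a ∈ insert x (insert v1 (insert v S)) := by rw [hu]; exact Finset.mem_univ _
        simpa [ha.1, ha.2.1, ha.2.2] using this
      have hr : ∀ a, ∃ i, (a ≠ v ∧ a ≠ v1 ∧ a ≠ x) → J i = π a := by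
        intro a
        by_cases ha : (a ≠ v ∧ a ≠ v1 ∧ a ≠ x)
        · rcases Finset.mem_insert.1 (US a ha) with e | e
          · exact ⟨z, fun _ => by rw [e, π3, hz]⟩
          · obtain ⟨i, -, rfl⟩ := Finset.mem_image.1 e
            exact ⟨i, fun _ => (πo _ (J3 i)).symm⟩
        · exact ⟨z, fun hh => absurd hh ha⟩
      choose r hr using hr
      have hrz2 : r v2 = z := hJ (by rw [hr v2 U2, πo v2 hv2v3, hz])
      have hrz3 : r v3 = z := hJ (by rw [hr v3 U3, π3, hz])
      have hrl : ∀ a b, (a ≠ v ∧ a ≠ v1 ∧ a ≠ x) → (b ≠ v ∧ b ≠ v1 ∧ b ≠ x) → G.Adj a b →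
          K.Adj (r a) (r b) ∧ ℓ (r a, r b) = (a, b) := by
        intro a b ha hb hab
        have : (a, b) ∈ (prs K Finset.univ).image ℓ := by
          rw [himage]; exact mem_prs.2 ⟨US a ha, US b hb, hab⟩
        obtain ⟨p, hp, he⟩ := Finset.mem_image.1 this
        have hp' := (mem_prs.1 hp).2.2
        obtain ⟨-, -, h1, h2, -⟩ := hℓ p hp'
        rw [he] at h1 h2
        have e1 : p.1 = r a := hJ (by rw [hr a ha]; exact h1.symm)
        have e2 : p.2 = r b := hJ (by rw [hr b hb]; exact h2.symm)
        rw [← e1, ← e2]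
        exact ⟨hp', he⟩
      have huniq : ∀ b, (b ≠ v ∧ b ≠ v1 ∧ b ≠ x) → G.Adj v2 b → G.Adj v3 b → False := by
        intro b hb h1 h2
        have e1 := (hrl _ _ U2 hb h1).2
        have e2 := (hrl _ _ U3 hb h2).2
        rw [hrz2] at e1
        rw [hrz3, e1] at e2
        exact hv2v3 (congrArg Prod.fst e2)
      -- `r` is injective on neighbors of `v2` and `v3`
      have hJr : ∀ b, (b ≠ v ∧ b ≠ v1 ∧ b ≠ x) → (G.Adj v2 b ∨ G.Adj v3 b) → J (r b) = b := by
        intro b hb hbb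
        rw [hr b hb]
        apply πo
        rintro rfl
        rcases hbb with h1 | h1
        · exact h23 h1
        · exact h1.ne rfl
      have hrzz : ∀ b, (b ≠ v ∧ b ≠ v1 ∧ b ≠ x) → r b = z → b = v2 ∨ b = v3 := by
        intro b hb hbz
        have := hr b hb
        rw [hbz, hz] at this
        rcases lift_cases _ _ this.symm with e | ⟨e, -⟩
        · exact Or.inl e
        · exact Or.inr e
      obtain ⟨b2, hb2U, hb2⟩ := ex2
      obtain ⟨b3, hb3U, hb3⟩ := ex3
      by_cases hone2 : ∀ b, (b ≠ v ∧ b ≠ v1 ∧ b ≠ x) → G.Adj v2 b → b = b2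
      · apply hncol
        refine final_col nvv1 nvx nv1x hNv hNv1 hNx Uy U2 U3 hv2v3 hFlex r z (r b2)
          (fun a b ha hb hab => (hrl a b ha hb hab).1) hrz3 hrzz ?_ ?_ ?_
        · intro b hb hab
          rw [hone2 b hb hab]
        · intro b hb hab he
          have : b = b2 := by
            rw [← hJr b hb (Or.inr hab), he, hJr b2 hb2U (Or.inl hb2)]
          exact huniq b hb (this ▸ hb2) hab
        · have := (hrl _ _ U2 hb2U hb2).1
          rwa [hrz2] at this
      by_cases hone3 : ∀ b, (b ≠ v ∧ b ≠ v1 ∧ b ≠ x) → G.Adj v3 b → b = b3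
      · apply hncol
        refine final_col nvv1 nvx nv1x (fun b hb => ?_) hNv1 hNx Uy U3 U2 hv2v3.symm hFlex r z (r b3)
          (fun a b ha hb hab => (hrl a b ha hb hab).1) hrz2 (fun b hb hbz => (hrzz b hb hbz).symm)
          ?_ ?_ ?_
        · rcases hNv b hb with e | e | e
          · exact Or.inl e
          · exact Or.inr (Or.inr e)
          · exact Or.inr (Or.inl e)
        · intro b hb hab
          rw [hone3 b hb hab]
        · intro b hb hab he
          have : b = b3 := by
            rw [← hJr b hb (Or.inl hab), he, hJr b3 hb3U (Or.inr hb3)]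
          exact huniq b hb hab (this ▸ hb3)
        · have := (hrl _ _ U3 hb3U hb3).1
          rwa [hrz3] at this
      push Not at hone2 hone3
      obtain ⟨c2, hc2U, hc2, hc2ne⟩ := hone2
      obtain ⟨c3, hc3U, hc3, hc3ne⟩ := hone3
      have A2 : ∀ b, (b ≠ v ∧ b ≠ v1 ∧ b ≠ x) → G.Adj v2 b → K.Adj z (r b) := by
        intro b hb hab
        have := (hrl _ _ U2 hb hab).1
        rwa [hrz2] at this
      have A3 : ∀ b, (b ≠ v ∧ b ≠ v1 ∧ b ≠ x) → G.Adj v3 b → K.Adj z (r b) := by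
        intro b hb hab
        have := (hrl _ _ U3 hb hab).1
        rwa [hrz3] at this
      have hne : ∀ b b', (b ≠ v ∧ b ≠ v1 ∧ b ≠ x) → (b' ≠ v ∧ b' ≠ v1 ∧ b' ≠ x) →
          G.Adj v2 b → G.Adj v3 b' → r b = r b' → False := by
        intro b b' hb hb' h1 h2 he
        have : b = b' := by
          rw [← hJr b hb (Or.inl h1), he, hJr b' hb' (Or.inr h2)]
        exact huniq b hb h1 (this ▸ h2)
      rcases hSub z (r b2) (r c2) (r b3) (r c3) (A2 _ hb2U hb2) (A2 _ hc2U hc2) (A3 _ hb3U hb3)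
        (A3 _ hc3U hc3)
        (fun he => hc2ne (by rw [← hJr b2 hb2U (Or.inl hb2), he, hJr c2 hc2U (Or.inl hc2)]))
        (fun he => hc3ne (by rw [← hJr b3 hb3U (Or.inr hb3), he, hJr c3 hc3U (Or.inr hc3)]))
        with e | e | e | e
      · exact hne _ _ hb2U hb3U hb2 hb3 e
      · exact hne _ _ hb2U hc3U hb2 hc3 e
      · exact hne _ _ hc2U hb3U hc2 hb3 e
      · exact hne _ _ hc2U hc3U hc2 hc3 e
    · have := dpot_ge h _ hu (by
        rw [Finset.card_insert_of_notMem nx, Finset.card_insert_of_notMem n1, hHcard]; omega)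
      push_cast at hH hH1 hH2
      omega
  · -- `y` is outside
    have hne : insert v S ≠ Finset.univ := by
      intro hu
      exact n1 (hu ▸ Finset.mem_univ _)
    obtain ⟨F', hss, hF'⟩ := step h (insert v S) hne (by omega)
    have hdH : dpot G (insert v S) ≤ 8 := by
      push_cast at hH; omega
    have hss' := Finset.card_lt_card hss
    by_cases hu : F' = Finset.univ
    · rw [hu] at hF'
      rcases hF' with hF' | ⟨-, hF'⟩
      · omega
      · have ny : y ∉ insert x (insert v1 (insert v S)) := by
          simp [Uy.1, Uy.2.1, Uy.2.2, hyS]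
        have h1 := Finset.card_le_univ (insert y (insert x (insert v1 (insert v S))))
        rw [Finset.card_insert_of_notMem ny, Finset.card_insert_of_notMem nx,
          Finset.card_insert_of_notMem n1] at h1
        rw [Finset.card_univ] at hF'
        omega
    · have := dpot_ge h F' hu (by omega)
      omega
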